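/- (Riemann's addition theorem, in the form used.) Let g ≥ 1, let τ be an element of the Siegel upper half-space H_g, let z, x ∈ ℂ^g, and let α, β, ε ∈ ℤ^g. Then θ[α,β](2τ,2z)·θ[α+ε,β](2τ,2x) = 2^{−g} Σ_{σ ∈ {0,1}^g} (−1)^{α·σ} θ[ε,β+σ](τ,z+x)·θ[ε,σ](τ,z−x), where the sum ranges over the 2^g vectors σ ∈ {0,1}^g ⊂ ℤ^g and sums of characteristics such as α+ε and β+σ are literal sums of integer vectors. -/

import Mathlib

open scoped BigOperators
open Complex

noncomputable section

/-- The Siegel upper half-space condition: a complex symmetric `g × g` matrix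
whose imaginary part is positive definite. -/
def IsSiegel {g : ℕ} (τ : Matrix (Fin g) (Fin g) ℂ) : Prop :=
  τ.IsSymm ∧ Matrix.PosDef (Matrix.of fun i j => (τ i j).im)

/-- The theta function with characteristic `[ε, δ]`:
`θ[ε,δ](τ,z) = Σ_{m ∈ ℤ^g} exp(πi((m+ε/2)ᵀτ(m+ε/2) + 2(m+ε/2)·(z+δ/2)))`. -/
def theta {g : ℕ} (τ : Matrix (Fin g) (Fin g) ℂ) (ε δ : Fin g → ℤ)
    (z : Fin g → ℂ) : ℂ :=
  ∑' m : Fin g → ℤ,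
    Complex.exp (↑Real.pi * Complex.I *
      ((∑ i, ∑ j, ((m i : ℂ) + (ε i : ℂ) / 2) * τ i j * ((m j : ℂ) + (ε j : ℂ) / 2)) +
        2 * ∑ i, ((m i : ℂ) + (ε i : ℂ) / 2) * (z i + (δ i : ℂ) / 2)))

/-- The summand at `m` of the series defining `theta τ ε δ z`. -/
def thetaTerm {g : ℕ} (τ : Matrix (Fin g) (Fin g) ℂ) (ε δ : Fin g → ℤ)
    (z : Fin g → ℂ) (m : Fin g → ℤ) : ℂ :=
  Complex.exp (↑Real.pi * Complex.I *
    ((∑ i, ∑ j, ((m i : ℂ) + (ε i : ℂ) / 2) * τ i j * ((m j : ℂ) + (ε j : ℂ) / 2)) +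
      2 * ∑ i, ((m i : ℂ) + (ε i : ℂ) / 2) * (z i + (δ i : ℂ) / 2)))

lemma theta_eq_tsum_thetaTerm {g : ℕ} (τ : Matrix (Fin g) (Fin g) ℂ) (ε δ : Fin g → ℤ)
    (z : Fin g → ℂ) : theta τ ε δ z = ∑' m, thetaTerm τ ε δ z m := rfl

lemma Matrix.PosDef.exists_pos_mul_sum_sq_le {n : Type*} [Fintype n] {Y : Matrix n n ℝ}
    (hY : Y.PosDef) :
    ∃ c : ℝ, 0 < c ∧ ∀ v : n → ℝ, c * ∑ i, v i ^ 2 ≤ ∑ i, ∑ j, v i * Y i j * v j := by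
  set Q : (n → ℝ) → ℝ := fun v => ∑ i, ∑ j, v i * Y i j * v j with hQ
  have hQc : Continuous Q := by fun_prop
  have hQpos : ∀ v ≠ 0, 0 < Q v := by
    intro v hv
    have h := hY.dotProduct_mulVec_pos hv
    simpa [hQ, dotProduct, Matrix.mulVec, Finset.mul_sum, mul_assoc] using h
  have hQsmul : ∀ (t : ℝ) v, Q (t • v) = t ^ 2 * Q v := by
    intro t v
    simp only [hQ, Pi.smul_apply, smul_eq_mul, Finset.mul_sum]
    exact Finset.sum_congr rfl fun i _ => Finset.sum_congr rfl fun j _ => by ring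
  obtain ⟨c, hc, hcQ⟩ := (isCompact_sphere (0 : n → ℝ) 1).exists_forall_le' (a := 0)
    hQc.continuousOn fun v hv => hQpos v (Metric.ne_of_mem_sphere hv one_ne_zero)
  have hnorm : ∀ v, c * ‖v‖ ^ 2 ≤ Q v := by
    intro v
    rcases eq_or_ne v 0 with rfl | hv
    · simp [hQ]
    have hv' : ‖v‖ ≠ 0 := norm_ne_zero_iff.mpr hv
    have h := hcQ (‖v‖⁻¹ • v) (by simp [norm_smul, hv'])
    rw [hQsmul, inv_pow, ← div_eq_inv_mul, le_div_iff₀ (by positivity)] at h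
    exact h
  refine ⟨c / (Fintype.card n + 1), by positivity, fun v => le_trans ?_ (hnorm v)⟩
  have hsum : ∑ i, v i ^ 2 ≤ (Fintype.card n + 1) * ‖v‖ ^ 2 := by
    have h : ∑ i, v i ^ 2 ≤ Fintype.card n • ‖v‖ ^ 2 :=
      Finset.sum_le_card_nsmul _ _ _ fun i _ => by
        simpa using pow_le_pow_left₀ (norm_nonneg _) (norm_le_pi_norm v i) 2
    rw [nsmul_eq_mul] at h
    nlinarith [sq_nonneg ‖v‖]
  rw [div_mul_eq_mul_div, div_le_iff₀ (by positivity)]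
  nlinarith

lemma summable_prod_pi {g : ℕ} {ι : Type*} {f : Fin g → ι → ℝ} (hf : ∀ i, Summable (f i))
    (hf0 : ∀ i n, 0 ≤ f i n) : Summable fun m : Fin g → ι => ∏ i, f i (m i) := by
  induction g with
  | zero => exact Summable.of_finite
  | succ g ih =>
    rw [← (Fin.consEquiv fun _ => ι).summable_iff]
    refine ((hf 0).mul_of_nonneg (ih (fun i => hf i.succ) fun i => hf0 i.succ) (hf0 0)
      fun m => Finset.prod_nonneg fun i _ => hf0 _ _).congr fun p => ?_
    simp [Fin.prod_univ_succ, Fin.consEquiv]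

lemma summable_exp_neg_quadratic {c : ℝ} (hc : 0 < c) (a y : ℝ) :
    Summable fun n : ℤ => Real.exp (-Real.pi * (c * (n + a) ^ 2 + 2 * ((n + a) * y))) := by
  have h := ((summable_jacobiTheta₂_term_iff ((c * a + y : ℝ) * I) (c * I)).mpr
    (by simpa using hc)).norm.mul_left (Real.exp (-Real.pi * (c * a ^ 2 + 2 * (a * y))))
  refine h.congr fun n => ?_
  rw [norm_jacobiTheta₂_term, ← Real.exp_add]
  congr 1
  simp only [im_ofReal_mul, I_im]
  ring

lemma norm_thetaTerm {g : ℕ} (τ : Matrix (Fin g) (Fin g) ℂ) (ε δ : Fin g → ℤ)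
    (z : Fin g → ℂ) (m : Fin g → ℤ) :
    ‖thetaTerm τ ε δ z m‖ = Real.exp (-Real.pi *
      ((∑ i, ∑ j, ((m i : ℝ) + (ε i : ℝ) / 2) * (τ i j).im * ((m j : ℝ) + (ε j : ℝ) / 2)) +
        2 * ∑ i, ((m i : ℝ) + (ε i : ℝ) / 2) * (z i).im)) := by
  have hcast : ∀ i, (m i : ℂ) + (ε i : ℂ) / 2 = ((m i + ε i / 2 : ℝ) : ℂ) := by
    intro i; push_cast; rfl
  have hδ : ∀ i, (δ i : ℂ) / 2 = ((δ i / 2 : ℝ) : ℂ) := by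
    intro i; push_cast; rfl
  rw [thetaTerm, Complex.norm_exp, mul_assoc, re_ofReal_mul, I_mul_re, add_im,
    show (2 : ℂ) = ((2 : ℝ) : ℂ) by norm_num, im_ofReal_mul, im_sum, im_sum]
  simp only [im_sum]
  rw [show ((2 : ℝ) : ℂ) = 2 by norm_num]
  simp only [hcast, hδ, im_mul_ofReal, im_ofReal_mul, add_im, ofReal_im, add_zero]
  ring_nf

lemma summable_norm_thetaTerm {g : ℕ} {τ : Matrix (Fin g) (Fin g) ℂ} (hτ : IsSiegel τ)
    (ε δ : Fin g → ℤ) (z : Fin g → ℂ) : Summable fun m => ‖thetaTerm τ ε δ z m‖ := by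
  obtain ⟨c, hc, hcQ⟩ := hτ.2.exists_pos_mul_sum_sq_le
  refine Summable.of_nonneg_of_le (fun _ => norm_nonneg _) (fun m => ?_)
    (summable_prod_pi (fun i => summable_exp_neg_quadratic hc (ε i / 2) (z i).im)
      fun _ _ => (Real.exp_pos _).le)
  rw [norm_thetaTerm, ← Real.exp_sum, ← Finset.mul_sum, Finset.sum_add_distrib,
    ← Finset.mul_sum, ← Finset.mul_sum]
  refine Real.exp_le_exp.mpr (mul_le_mul_of_nonpos_left ?_ (by linarith [Real.pi_pos]))
  gcongr
  exact hcQ fun i => (m i : ℝ) + ε i / 2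

lemma IsSiegel.two_smul {g : ℕ} {τ : Matrix (Fin g) (Fin g) ℂ} (hτ : IsSiegel τ) :
    IsSiegel ((2 : ℂ) • τ) := by
  refine ⟨hτ.1.smul 2, ?_⟩
  convert! hτ.2.smul (zero_lt_two (α := ℝ)) using 1
  ext i j
  simp

lemma neg_one_zpow_eq_exp (n : ℤ) : (-1 : ℂ) ^ n = Complex.exp (Real.pi * I * n) := by
  rw [← Complex.exp_pi_mul_I, ← Complex.exp_int_mul, mul_comm]

lemma neg_one_zpow_sum {ι : Type*} (s : Finset ι) (f : ι → ℤ) :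
    (-1 : ℂ) ^ (∑ i ∈ s, f i) = ∏ i ∈ s, (-1 : ℂ) ^ f i := by
  simp only [neg_one_zpow_eq_exp, ← Complex.exp_sum, ← Finset.mul_sum, Int.cast_sum]

lemma sum_neg_one_zpow_dot {g : ℕ} (c : Fin g → ℤ) :
    ∑ σ : Fin g → Fin 2, (-1 : ℂ) ^ (∑ k, c k * ((σ k : ℕ) : ℤ)) =
      if ∀ k, Even (c k) then (2 : ℂ) ^ g else 0 := by
  simp only [neg_one_zpow_sum]
  rw [← Fintype.prod_sum fun k (s : Fin 2) => (-1 : ℂ) ^ (c k * ((s : ℕ) : ℤ))]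
  simp only [Fin.sum_univ_two, Fin.val_zero, Fin.val_one, Nat.cast_zero, Nat.cast_one, mul_zero,
    mul_one, zpow_zero]
  split_ifs with h
  · rw [Finset.prod_congr rfl fun k _ => by rw [(h k).neg_one_zpow, one_add_one_eq_two]]
    simp
  · push Not at h
    obtain ⟨k, hk⟩ := h
    exact Finset.prod_eq_zero (Finset.mem_univ k) (by
      simp [(Int.not_even_iff_odd.mp hk).neg_one_zpow])

lemma thetaTerm_add_mul_thetaTerm {g : ℕ} (τ : Matrix (Fin g) (Fin g) ℂ) (ε β σ : Fin g → ℤ)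
    (w y : Fin g → ℂ) (m n : Fin g → ℤ) :
    thetaTerm τ ε (β + σ) w m * thetaTerm τ ε σ y n =
      (-1 : ℂ) ^ (∑ k, (m k + n k + ε k) * σ k) *
        (thetaTerm τ ε β w m * thetaTerm τ ε 0 y n) := by
  simp only [thetaTerm, neg_one_zpow_eq_exp, ← Complex.exp_add]
  congr 1
  simp only [← mul_add]
  congr 1
  have h : ∑ i, ((m i : ℂ) + ε i / 2) * (w i + ((β + σ) i : ℤ) / 2) * 2 +
      ∑ i, ((n i : ℂ) + ε i / 2) * (y i + (σ i : ℂ) / 2) * 2 =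
      ∑ i, ((m i : ℂ) + n i + ε i) * σ i + ∑ i, ((m i : ℂ) + ε i / 2) * (w i + (β i : ℂ) / 2) * 2 +
      ∑ i, ((n i : ℂ) + ε i / 2) * (y i + ((0 : Fin g → ℤ) i : ℂ) / 2) * 2 := by
    simp only [← Finset.sum_add_distrib]
    refine Finset.sum_congr rfl fun i _ => ?_
    simp only [Pi.add_apply, Pi.zero_apply]
    push_cast
    ring
  simp only [← Finset.sum_mul] at h
  push_cast
  linear_combination h

lemma thetaTerm_mul_thetaTerm_rotate {g : ℕ} (τ : Matrix (Fin g) (Fin g) ℂ)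
    (z x : Fin g → ℂ) (α β ε p q : Fin g → ℤ) :
    thetaTerm τ ε β (z + x) (p + q + α) * thetaTerm τ ε 0 (z - x) (p - q - ε) =
      thetaTerm ((2 : ℂ) • τ) α β (fun k => 2 * z k) p *
        thetaTerm ((2 : ℂ) • τ) (α + ε) β (fun k => 2 * x k) q := by
  simp only [thetaTerm, ← Complex.exp_add, ← mul_add]
  congr 2
  simp only [Finset.mul_sum, ← Finset.sum_add_distrib]
  refine Finset.sum_congr rfl fun i _ => ?_
  have quad : ∑ j, (((p + q + α) i : ℤ) + (ε i : ℂ) / 2) * τ i j *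
        (((p + q + α) j : ℤ) + (ε j : ℂ) / 2) +
      ∑ j, (((p - q - ε) i : ℤ) + (ε i : ℂ) / 2) * τ i j *
        (((p - q - ε) j : ℤ) + (ε j : ℂ) / 2) =
      ∑ j, ((p i : ℂ) + (α i : ℂ) / 2) * ((2 : ℂ) • τ) i j * ((p j : ℂ) + (α j : ℂ) / 2) +
      ∑ j, ((q i : ℂ) + ((α + ε) i : ℤ) / 2) * ((2 : ℂ) • τ) i j *
        ((q j : ℂ) + ((α + ε) j : ℤ) / 2) := by
    simp only [← Finset.sum_add_distrib]
    refine Finset.sum_congr rfl fun j _ => ?_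
    simp only [Pi.add_apply, Pi.sub_apply, Matrix.smul_apply, smul_eq_mul]
    push_cast
    ring
  have lin : (((p + q + α) i : ℤ) + (ε i : ℂ) / 2) * ((z + x) i + (β i : ℂ) / 2) +
      (((p - q - ε) i : ℤ) + (ε i : ℂ) / 2) * ((z - x) i + ((0 : Fin g → ℤ) i : ℂ) / 2) =
      ((p i : ℂ) + (α i : ℂ) / 2) * (2 * z i + (β i : ℂ) / 2) +
      ((q i : ℂ) + ((α + ε) i : ℤ) / 2) * (2 * x i + (β i : ℂ) / 2) := by
    simp only [Pi.add_apply, Pi.sub_apply, Pi.zero_apply]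
    push_cast
    ring
  linear_combination quad + 2 * lin

lemma rotate_injective {g : ℕ} (α ε : Fin g → ℤ) :
    Function.Injective fun r : (Fin g → ℤ) × (Fin g → ℤ) =>
      (r.1 + r.2 + α, r.1 - r.2 - ε) := by
  rintro ⟨p, q⟩ ⟨p', q'⟩ h
  simp only [Prod.mk.injEq, funext_iff, Pi.add_apply, Pi.sub_apply] at h ⊢
  exact ⟨fun k => by have := h.1 k; have := h.2 k; omega,
    fun k => by have := h.1 k; have := h.2 k; omega⟩

lemma mem_range_rotate {g : ℕ} {α ε m n : Fin g → ℤ} (h : ∀ k, Even (α k + (m k + n k + ε k))) :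
    (m, n) ∈ Set.range fun r : (Fin g → ℤ) × (Fin g → ℤ) =>
      (r.1 + r.2 + α, r.1 - r.2 - ε) := by
  choose t ht using h
  refine ⟨(fun k => t k - α k, fun k => m k - t k), ?_⟩
  ext k <;> simp only [Pi.add_apply, Pi.sub_apply] <;> have := ht k <;> omega

theorem statement6 {g : ℕ} (hg : 1 ≤ g) (τ : Matrix (Fin g) (Fin g) ℂ)
    (hτ : IsSiegel τ) (z x : Fin g → ℂ) (α β ε : Fin g → ℤ) :
    theta ((2 : ℂ) • τ) α β (fun k => 2 * z k) *
        theta ((2 : ℂ) • τ) (α + ε) β (fun k => 2 * x k) =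
      (2 : ℂ) ^ (-(g : ℤ)) *
        ∑ σ : Fin g → Fin 2,
          (-1 : ℂ) ^ (∑ k, α k * ((σ k : ℕ) : ℤ)) *
            (theta τ ε (β + fun k => ((σ k : ℕ) : ℤ)) (z + x) *
              theta τ ε (fun k => ((σ k : ℕ) : ℤ)) (z - x)) := by
  have hs := summable_norm_thetaTerm hτ
  have hs2 := summable_norm_thetaTerm hτ.two_smul
  simp only [theta_eq_tsum_thetaTerm]
  rw [tsum_mul_tsum_of_summable_norm (hs2 _ _ _) (hs2 _ _ _)]
  simp_rw [tsum_mul_tsum_of_summable_norm (hs _ _ _) (hs _ _ _), ← tsum_mul_left]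
  rw [← Summable.tsum_finsetSum fun σ _ =>
    (summable_mul_of_summable_norm (hs _ _ _) (hs _ _ _)).mul_left _, ← tsum_mul_left]
  have key : ∀ r : (Fin g → ℤ) × (Fin g → ℤ),
      (2 : ℂ) ^ (-(g : ℤ)) * ∑ σ : Fin g → Fin 2, (-1 : ℂ) ^ (∑ k, α k * ((σ k : ℕ) : ℤ)) *
        (thetaTerm τ ε (β + fun k => ((σ k : ℕ) : ℤ)) (z + x) r.1 *
          thetaTerm τ ε (fun k => ((σ k : ℕ) : ℤ)) (z - x) r.2) =
      if ∀ k, Even (α k + (r.1 k + r.2 k + ε k)) then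
        thetaTerm τ ε β (z + x) r.1 * thetaTerm τ ε 0 (z - x) r.2 else 0 := by
    intro r
    have hσ : ∀ σ : Fin g → Fin 2, (-1 : ℂ) ^ (∑ k, α k * ((σ k : ℕ) : ℤ)) *
        (thetaTerm τ ε (β + fun k => ((σ k : ℕ) : ℤ)) (z + x) r.1 *
          thetaTerm τ ε (fun k => ((σ k : ℕ) : ℤ)) (z - x) r.2) =
        (-1 : ℂ) ^ (∑ k, (α k + (r.1 k + r.2 k + ε k)) * ((σ k : ℕ) : ℤ)) *
          (thetaTerm τ ε β (z + x) r.1 * thetaTerm τ ε 0 (z - x) r.2) := by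
      intro σ
      rw [thetaTerm_add_mul_thetaTerm, ← mul_assoc, ← zpow_add₀ (by norm_num),
        ← Finset.sum_add_distrib]
      simp only [add_mul]
    rw [Finset.sum_congr rfl fun σ _ => hσ σ, ← Finset.sum_mul, sum_neg_one_zpow_dot, ← mul_assoc]
    split_ifs
    · rw [zpow_neg, zpow_natCast, inv_mul_cancel₀ (pow_ne_zero g two_ne_zero), one_mul]
    · simp
  rw [tsum_congr key]
  symm
  rw [← (rotate_injective α ε).tsum_eq]
  · refine tsum_congr fun r => ?_
    rw [if_pos, thetaTerm_mul_thetaTerm_rotate]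
    intro k
    exact ⟨α k + r.1 k, by simp only [Pi.add_apply, Pi.sub_apply]; ring⟩
  · intro r hr
    by_contra hrange
    exact hr (if_neg fun h => hrange (mem_range_rotate h))
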